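/- If ≿ has an ECU representation, then ≿ satisfies Replacement Monotonicity: for all x ∈ X and α ∈ [0,1], αδ_b + (1-α)δ_x ≿ αδ_b + (1-α)δ_w and αδ_b + (1-α)δ_w ≿ αδ_x + (1-α)δ_w. -/

import Mathlib

open Set

noncomputable section

/-- The Dirac lottery `δ_x` at a prize `x`. -/
def delta (x : ℝ) : ℝ → ℝ := fun y => if y = x then 1 else 0

/-- `p` is a simple lottery on the prize space `X = [w, b]`: a finitely supported
function into `[0,1]` vanishing outside `[w,b]` and summing to `1`. -/
def IsLottery (w b : ℝ) (p : ℝ → ℝ) : Prop :=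
  (Function.support p).Finite ∧ (∀ x, 0 ≤ p x ∧ p x ≤ 1) ∧
    (∀ x, x ∉ Icc w b → p x = 0) ∧ (∑ᶠ x, p x) = 1

/-- The probability `p(S)` that a lottery assigns to a set of prizes. -/
def prob (p : ℝ → ℝ) (S : Set ℝ) : ℝ := ∑ᶠ x ∈ S, p x

/-- Indifference: the symmetric part `∼` of `≿`. -/
def Indiff (R : (ℝ → ℝ) → (ℝ → ℝ) → Prop) (p q : ℝ → ℝ) : Prop := R p q ∧ R q p

/-- Strict preference: the asymmetric part `≻` of `≿`. -/
def StrictPref (R : (ℝ → ℝ) → (ℝ → ℝ) → Prop) (p q : ℝ → ℝ) : Prop := R p q ∧ ¬ R q p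

/-- Axiom 1 (first half): `≿` is complete on simple lotteries. -/
def CompleteAx (w b : ℝ) (R : (ℝ → ℝ) → (ℝ → ℝ) → Prop) : Prop :=
  ∀ p q, IsLottery w b p → IsLottery w b q → R p q ∨ R q p

/-- Axiom 1 (second half): `≿` is transitive on simple lotteries. -/
def TransitiveAx (w b : ℝ) (R : (ℝ → ℝ) → (ℝ → ℝ) → Prop) : Prop :=
  ∀ p q r, IsLottery w b p → IsLottery w b q → IsLottery w b r → R p q → R q r → R p r

/-- Axiom 2 (Monotonicity). -/
def MonotonicityAx (w b : ℝ) (R : (ℝ → ℝ) → (ℝ → ℝ) → Prop) : Prop :=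
  ∀ t₁ ∈ Icc (0:ℝ) 1, ∀ t₂ ∈ Icc (0:ℝ) 1,
    (R (t₁ • delta b + (1 - t₁) • delta w) (t₂ • delta b + (1 - t₂) • delta w) ↔ t₂ ≤ t₁)

/-- Axiom 3 (Replacement Monotonicity). -/
def ReplacementMonotonicityAx (w b : ℝ) (R : (ℝ → ℝ) → (ℝ → ℝ) → Prop) : Prop :=
  ∀ x ∈ Icc w b, ∀ α ∈ Icc (0:ℝ) 1,
    R (α • delta b + (1 - α) • delta x) (α • delta b + (1 - α) • delta w) ∧
    R (α • delta b + (1 - α) • delta w) (α • delta x + (1 - α) • delta w)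

/-- Axiom 4 (Weak Solvability). -/
def WeakSolvabilityAx (w b : ℝ) (R : (ℝ → ℝ) → (ℝ → ℝ) → Prop) : Prop :=
  ∀ p, IsLottery w b p → ∃ γ ∈ Icc (0:ℝ) 1, Indiff R p (γ • delta b + (1 - γ) • delta w)

/-- A family `u π` of utility functions, indexed by the disappointment probability
`π ∈ [0,1]`, is contextual for the threshold `d`. -/
def Contextual (w b d : ℝ) (u : ℝ → ℝ → ℝ) : Prop :=
  (∀ π ∈ Icc (0:ℝ) 1, ∀ μ ∈ Icc (0:ℝ) 1, u π w = u μ w ∧ u π b = u μ b) ∧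
  (∀ π ∈ Icc (0:ℝ) 1, u π w < u π b) ∧
  (∀ π ∈ Icc (0:ℝ) 1, ∀ x ∈ Ioo w b, u π x ∈ Icc (u π w) (u π b)) ∧
  (d ≠ b → ∀ x ∈ Ioo w b, ∃ π ∈ Ioo (0:ℝ) 1, ∃ μ ∈ Ioo (0:ℝ) 1, u π x ≠ u μ x)

/-- The ECU value of a lottery `p`: `V(p) = ∑ₓ p(x) · u_π(x)` where `π = p([w,d])`. -/
def ECUval (w b d : ℝ) (u : ℝ → ℝ → ℝ) (p : ℝ → ℝ) : ℝ :=
  ∑ᶠ x, p x * u (prob p (Icc w d)) x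

/-- `(d, u)` is an expected contextual utility (ECU) representation of `≿`. -/
def IsECU (w b : ℝ) (R : (ℝ → ℝ) → (ℝ → ℝ) → Prop) (d : ℝ) (u : ℝ → ℝ → ℝ) : Prop :=
  d ∈ Icc w b ∧ Contextual w b d u ∧
    ∀ p q, IsLottery w b p → IsLottery w b q →
      (R p q ↔ ECUval w b d u q ≤ ECUval w b d u p)

/-- `φ` assigns to each prize `x` the value `φ_x ∈ [0,1]` with `δ_x ∼ φ_x δ_b + (1-φ_x) δ_w`. -/
def IsPhi (w b : ℝ) (R : (ℝ → ℝ) → (ℝ → ℝ) → Prop) (φ : ℝ → ℝ) : Prop :=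
  ∀ x ∈ Icc w b, φ x ∈ Icc (0:ℝ) 1 ∧
    Indiff R (delta x) (φ x • delta b + (1 - φ x) • delta w)

/-- The set `𝒟` defined from the preference relation via the values `φ_x`. -/
def Dset (w b : ℝ) (R : (ℝ → ℝ) → (ℝ → ℝ) → Prop) (φ : ℝ → ℝ) : Set ℝ :=
  { x | x ∈ Ico w b ∧ ∀ α ∈ Icc (0:ℝ) 1,
      Indiff R (α • delta x + (1 - α) • delta w)
        ((α * φ x) • delta b + (α * (1 - φ x)) • delta w + (1 - α) • delta w) }

theorem finsum_mix_mul (x y s t : ℝ) (f : ℝ → ℝ) :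
    ∑ᶠ z, (s • delta x + t • delta y) z * f z = s * f x + t * f y := by
  have hfin : Function.support (fun z => (s • delta x + t • delta y) z * f z) ⊆
      (({x, y} : Finset ℝ) : Set ℝ) := by
    intro z hz
    by_contra hmem
    have hne : z ≠ x ∧ z ≠ y := by simpa using hmem
    exact hz (by simp [delta, hne.1, hne.2])
  rw [finsum_eq_sum_of_support_subset _ hfin]
  by_cases hxy : x = y
  · subst hxy
    simp [delta, add_mul]
  · rw [Finset.sum_pair hxy]
    simp [delta, hxy, Ne.symm hxy]

theorem isLottery_mix {w b x y α : ℝ} (hx : x ∈ Icc w b) (hy : y ∈ Icc w b)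
    (hα : α ∈ Icc (0 : ℝ) 1) : IsLottery w b (α • delta x + (1 - α) • delta y) := by
  obtain ⟨h0, h1⟩ := hα
  refine ⟨(Set.toFinite {x, y}).subset ?_, ?_, ?_, ?_⟩
  · intro z hz
    by_contra hmem
    have hne : z ≠ x ∧ z ≠ y := by simpa using hmem
    exact hz (by simp [delta, hne.1, hne.2])
  · intro z
    simp only [delta, Pi.add_apply, Pi.smul_apply, smul_eq_mul]
    split_ifs <;> constructor <;> linarith
  · intro z hz
    have hzx : z ≠ x := fun h => hz (h ▸ hx)
    have hzy : z ≠ y := fun h => hz (h ▸ hy)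
    simp [delta, hzx, hzy]
  · simpa using finsum_mix_mul x y α (1 - α) (fun _ => 1)

theorem prob_mix_mem_Icc (x y : ℝ) {α : ℝ} (hα : α ∈ Icc (0 : ℝ) 1) (S : Set ℝ) :
    prob (α • delta x + (1 - α) • delta y) S ∈ Icc (0 : ℝ) 1 := by
  classical
  have heq : prob (α • delta x + (1 - α) • delta y) S =
      α * S.indicator 1 x + (1 - α) * S.indicator 1 y := by
    rw [← finsum_mix_mul, prob, finsum_mem_def]
    refine finsum_congr fun z => ?_
    by_cases hz : z ∈ S <;> simp [hz]
  obtain ⟨h0, h1⟩ := hα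
  rw [heq]
  simp only [Set.indicator_apply, Pi.one_apply]
  split_ifs <;> constructor <;> linarith

theorem Contextual.mem_Icc {w b d : ℝ} {u : ℝ → ℝ → ℝ} (hu : Contextual w b d u) {π x : ℝ}
    (hπ : π ∈ Icc (0 : ℝ) 1) (hx : x ∈ Icc w b) : u π x ∈ Icc (u 0 w) (u 0 b) := by
  obtain ⟨hconst, hlt, hmem, -⟩ := hu
  obtain ⟨hw, hb⟩ := hconst π hπ 0 (by simp)
  rw [← hw, ← hb]
  rcases hx.1.eq_or_lt with rfl | hwx
  · exact ⟨le_rfl, (hlt π hπ).le⟩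
  rcases hx.2.eq_or_lt with rfl | hxb
  · exact ⟨(hlt π hπ).le, le_rfl⟩
  exact hmem π hπ x ⟨hwx, hxb⟩

/-- The value of a binary lottery is the expectation of some utility in the family. -/
theorem exists_ECUval_mix (w b d : ℝ) (u : ℝ → ℝ → ℝ) (x y : ℝ) {α : ℝ}
    (hα : α ∈ Icc (0 : ℝ) 1) :
    ∃ π ∈ Icc (0 : ℝ) 1,
      ECUval w b d u (α • delta x + (1 - α) • delta y) = α * u π x + (1 - α) * u π y :=
  ⟨_, prob_mix_mem_Icc x y hα (Icc w d), finsum_mix_mul x y α (1 - α) _⟩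

/-- If `≿` has an ECU representation, then `≿` satisfies Replacement Monotonicity (Axiom 3). -/
theorem stmt_11 (w b : ℝ) (hwb : w < b) (R : (ℝ → ℝ) → (ℝ → ℝ) → Prop)
    (d : ℝ) (u : ℝ → ℝ → ℝ) (hECU : IsECU w b R d u) :
    ReplacementMonotonicityAx w b R := by
  obtain ⟨-, hu, hR⟩ := hECU
  intro x hx α hα
  have hw : w ∈ Icc w b := ⟨le_rfl, hwb.le⟩
  have hb : b ∈ Icc w b := ⟨hwb.le, le_rfl⟩
  have hα' : 0 ≤ 1 - α := sub_nonneg.2 hα.2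
  obtain ⟨π, hπ, hVw⟩ := exists_ECUval_mix w b d u b w hα
  rw [(hu.1 π hπ 0 (by simp)).1, (hu.1 π hπ 0 (by simp)).2] at hVw
  constructor
  · rw [hR _ _ (isLottery_mix hb hx hα) (isLottery_mix hb hw hα), hVw]
    obtain ⟨μ, hμ, hV⟩ := exists_ECUval_mix w b d u b x hα
    rw [hV, (hu.1 μ hμ 0 (by simp)).2]
    gcongr
    exact (hu.mem_Icc hμ hx).1
  · rw [hR _ _ (isLottery_mix hb hw hα) (isLottery_mix hx hw hα), hVw]
    obtain ⟨μ, hμ, hV⟩ := exists_ECUval_mix w b d u x w hα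
    rw [hV, (hu.1 μ hμ 0 (by simp)).1]
    have := hα.1
    gcongr
    exact (hu.mem_Icc hμ hx).2
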